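/- The trigonometric polynomial f(α,β,γ) = 2^{3/2} − cos(α+β+γ) − cos(−α+β+γ) − cos(α−β+γ) + cos(α+β−γ) is extremal in σ(1,1,1): f ∈ σ(1,1,1), and whenever f = g + h with g, h ∈ σ(1,1,1), there exists a real constant c ≥ 0 with g = c·f. -/

import Mathlib

open Complex ComplexOrder

noncomputable section

/-- The lattice box `Δ(1,1,1)`. -/
def Dbox (N₁ N₂ N₃ : ℕ) : Finset (ℤ × ℤ × ℤ) :=
  Finset.Icc (-(N₁ : ℤ), -(N₂ : ℤ), -(N₃ : ℤ)) ((N₁ : ℤ), (N₂ : ℤ), (N₃ : ℤ))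

/-- The character `exp(i(kα + ℓβ + mγ))`. -/
def eChar (δ : ℤ × ℤ × ℤ) (v : ℝ × ℝ × ℝ) : ℂ :=
  Complex.exp (Complex.I *
    ((δ.1 : ℂ) * (v.1 : ℂ) + (δ.2.1 : ℂ) * (v.2.1 : ℂ) + (δ.2.2 : ℂ) * (v.2.2 : ℂ)))

/-- `σ(N₁,N₂,N₃)`: trig polynomials with frequencies in `Δ(N₁,N₂,N₃)` taking only real
nonnegative values. -/
def sigmaSet (N₁ N₂ N₃ : ℕ) : Set ((ℝ × ℝ × ℝ) → ℂ) :=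
  { f | (∃ q : ℤ × ℤ × ℤ → ℂ, f = fun v => ∑ δ ∈ Dbox N₁ N₂ N₃, q δ * eChar δ v) ∧
        ∀ v, 0 ≤ f v }


lemma dbox_eq : Dbox 1 1 1 = ({-1,0,1} : Finset ℤ) ×ˢ (({-1,0,1} : Finset ℤ) ×ˢ ({-1,0,1} : Finset ℤ)) := by
  decide

lemma sum3 (F : ℤ → ℂ) : ∑ k ∈ ({-1,0,1} : Finset ℤ), F k = F (-1) + F 0 + F 1 := by
  rw [Finset.sum_insert (by decide), Finset.sum_insert (by decide), Finset.sum_singleton]; ring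

lemma sum27 (F : ℤ × ℤ × ℤ → ℂ) : ∑ δ ∈ Dbox 1 1 1, F δ =
    ∑ k ∈ ({-1,0,1} : Finset ℤ), ∑ l ∈ ({-1,0,1} : Finset ℤ), ∑ m ∈ ({-1,0,1} : Finset ℤ),
      F (k, l, m) := by
  rw [dbox_eq, Finset.sum_product]
  simp only [Finset.sum_product]

/-- Exponent pairing. -/
def pair (δ n : ℤ × ℤ × ℤ) : ℤ := δ.1 * n.1 + δ.2.1 * n.2.1 + δ.2.2 * n.2.2

/-- The points at which `f` vanishes are of this form. -/
def pt (n : ℤ × ℤ × ℤ) : ℝ × ℝ × ℝ :=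
  (Real.pi / 4 + n.1 * (Real.pi / 2), Real.pi / 4 + n.2.1 * (Real.pi / 2),
    -(Real.pi / 4) + n.2.2 * (Real.pi / 2))

lemma eChar_pt (δ n : ℤ × ℤ × ℤ) : eChar δ (pt n) = eChar δ (pt 0) * I ^ pair δ n := by
  have hI : I = Complex.exp (I * (Real.pi / 2)) := by
    rw [mul_comm, Complex.exp_mul_I]; simp
  have : I ^ pair δ n = Complex.exp ((pair δ n : ℂ) * (I * (Real.pi / 2))) := by
    rw [Complex.exp_int_mul, ← hI]
  rw [this, eChar, eChar, ← Complex.exp_add]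
  congr 1
  simp only [pt, pair]
  push_cast
  simp
  ring

lemma classes (F : ℤ × ℤ × ℤ → ℂ)
    (h0 : ∑ δ ∈ Dbox 1 1 1, F δ * I ^ pair δ (0,0,0) = 0)
    (h1 : ∑ δ ∈ Dbox 1 1 1, F δ * I ^ pair δ (2,2,0) = 0)
    (h2 : ∑ δ ∈ Dbox 1 1 1, F δ * I ^ pair δ (0,2,2) = 0)
    (h3 : ∑ δ ∈ Dbox 1 1 1, F δ * I ^ pair δ (2,0,2) = 0) :
    (F (0,0,0) + F (1,1,1) + F (1,1,-1) + F (1,-1,1) + F (1,-1,-1)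
      + F (-1,1,1) + F (-1,1,-1) + F (-1,-1,1) + F (-1,-1,-1) = 0) ∧
    (F (1,0,0) + F (-1,0,0) + F (0,1,1) + F (0,1,-1) + F (0,-1,1) + F (0,-1,-1) = 0) ∧
    (F (0,1,0) + F (0,-1,0) + F (1,0,1) + F (1,0,-1) + F (-1,0,1) + F (-1,0,-1) = 0) ∧
    (F (0,0,1) + F (0,0,-1) + F (1,1,0) + F (1,-1,0) + F (-1,1,0) + F (-1,-1,0) = 0) := by
  have e2 : I ^ (2:ℤ) = -1 := by exact (zpow_ofNat I 2).trans I_sq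
  have e2' : I ^ (-2:ℤ) = -1 := by rw [zpow_neg, e2]; norm_num
  have e4 : I ^ (4:ℤ) = 1 := by rw [show (4:ℤ) = 2 + 2 by norm_num, zpow_add₀ I_ne_zero, e2]; norm_num
  have e4' : I ^ (-4:ℤ) = 1 := by rw [zpow_neg, e4]; norm_num
  simp only [sum27, sum3, pair] at h0 h1 h2 h3
  norm_num [e2, e2', e4, e4'] at h0 h1 h2 h3
  refine ⟨?_, ?_, ?_, ?_⟩
  · linear_combination (h0 + h1 + h2 + h3) / 4
  · linear_combination (h0 - h1 + h2 - h3) / 4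
  · linear_combination (h0 - h1 - h2 + h3) / 4
  · linear_combination (h0 + h1 - h2 - h3) / 4

lemma classes' (F : ℤ × ℤ × ℤ → ℂ)
    (h0 : ∑ δ ∈ Dbox 1 1 1, F δ * I ^ pair δ (1,1,1) = 0)
    (h1 : ∑ δ ∈ Dbox 1 1 1, F δ * I ^ pair δ (-1,-1,1) = 0)
    (h2 : ∑ δ ∈ Dbox 1 1 1, F δ * I ^ pair δ (1,-1,-1) = 0)
    (h3 : ∑ δ ∈ Dbox 1 1 1, F δ * I ^ pair δ (-1,1,-1) = 0) :
    (F (0,0,0) - I * F (1,1,1) + I * F (1,1,-1) + I * F (1,-1,1) - I * F (1,-1,-1)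
      + I * F (-1,1,1) - I * F (-1,1,-1) - I * F (-1,-1,1) + I * F (-1,-1,-1) = 0) ∧
    (I * F (1,0,0) - I * F (-1,0,0) - F (0,1,1) + F (0,1,-1) + F (0,-1,1) - F (0,-1,-1) = 0) ∧
    (I * F (0,1,0) - I * F (0,-1,0) - F (1,0,1) + F (1,0,-1) + F (-1,0,1) - F (-1,0,-1) = 0) ∧
    (I * F (0,0,1) - I * F (0,0,-1) - F (1,1,0) + F (1,-1,0) + F (-1,1,0) - F (-1,-1,0) = 0) := by
  have e2 : I ^ (2:ℤ) = -1 := by exact (zpow_ofNat I 2).trans I_sq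
  have e2' : I ^ (-2:ℤ) = -1 := by rw [zpow_neg, e2]; norm_num
  have e3 : I ^ (3:ℤ) = -I := by rw [show (3:ℤ) = 2 + 1 by norm_num, zpow_add₀ I_ne_zero, e2]; simp
  have e3' : I ^ (-3:ℤ) = I := by rw [zpow_neg, e3]; simp
  have e1' : I ^ (-1:ℤ) = -I := by simp
  simp only [sum27, sum3, pair] at h0 h1 h2 h3
  norm_num [e2, e2', e3, e3', e1'] at h0 h1 h2 h3
  refine ⟨?_, ?_, ?_, ?_⟩
  · linear_combination (h0 + h1 + h2 + h3) / 4
  · linear_combination (h0 - h1 + h2 - h3) / 4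
  · linear_combination (h0 - h1 - h2 + h3) / 4
  · linear_combination (h0 + h1 - h2 - h3) / 4

/-- The eight indices of zeros. -/
def Zs : Finset (ℤ × ℤ × ℤ) :=
  {(0,0,0), (2,2,0), (0,2,2), (2,0,2), (1,1,1), (-1,-1,1), (1,-1,-1), (-1,1,-1)}

/-- The universal ratio of shifted coefficients. -/
def Kc (δ : ℤ × ℤ × ℤ) : ℂ :=
  if δ = (0,0,0) then 1 else
    if δ.1 * δ.2.1 * δ.2.2 = 0 then 0 else -(1 + I * ((δ.1 * δ.2.1 * δ.2.2 : ℤ) : ℂ)) / 8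

lemma quad {a b x y z w : ℂ} (h1 : a + b + x + y + z + w = 0)
    (h1' : I * a - I * b - x + y + z - w = 0)
    (h2 : a - b = 0) (h2' : I * a + I * b = 0)
    (h3 : x + y - z - w = 0) (h4 : x - y + z - w = 0) :
    a = 0 ∧ b = 0 ∧ x = 0 ∧ y = 0 ∧ z = 0 ∧ w = 0 := by
  have hab : a + b = 0 := by
    have : I * (a + b) = 0 := by linear_combination h2'
    simpa using this
  have ha : a = 0 := by linear_combination (hab + h2) / 2
  have hb : b = 0 := by linear_combination (hab - h2) / 2
  subst ha hb
  refine ⟨rfl, rfl, ?_, ?_, ?_, ?_⟩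
  · linear_combination (h1 - h1' + h3 + h4) / 4
  · linear_combination (h1 + h1' + h3 - h4) / 4
  · linear_combination (h1 + h1' - h3 + h4) / 4
  · linear_combination (h1 - h1' - h3 - h4) / 4

lemma oct {o a b c d e f g h : ℂ}
    (h1 : o + a + b + c + d + e + f + g + h = 0)
    (h2 : o - I * a + I * b + I * c - I * d + I * e - I * f - I * g + I * h = 0)
    (x : a + b + c + d - e - f - g - h = 0)
    (x' : a - b - c + d + e - f - g + h = 0)
    (y : a + b - c - d + e + f - g - h = 0)
    (y' : a - b + c - d - e + f - g + h = 0)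
    (z : a - b + c - d + e - f + g - h = 0)
    (z' : a + b - c - d - e - f + g + h = 0) :
    a = -(1 + I) / 8 * o ∧ b = -(1 - I) / 8 * o ∧ c = -(1 - I) / 8 * o ∧ d = -(1 + I) / 8 * o
    ∧ e = -(1 - I) / 8 * o ∧ f = -(1 + I) / 8 * o ∧ g = -(1 + I) / 8 * o
    ∧ h = -(1 - I) / 8 * o := by
  have h2' : a - b - c + d - e + f + g - h + I * o = 0 := by
    linear_combination I * h2 + (a - b - c + d - e + f + g - h) * I_sq
  refine ⟨?_, ?_, ?_, ?_, ?_, ?_, ?_, ?_⟩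
  · linear_combination (h1 + h2' + x + x' + y + y' + z + z') / 8
  · linear_combination (h1 - h2' + x - x' + y - y' - z + z') / 8
  · linear_combination (h1 - h2' + x - x' - y + y' + z - z') / 8
  · linear_combination (h1 + h2' + x + x' - y - y' - z - z') / 8
  · linear_combination (h1 - h2' - x + x' + y - y' + z - z') / 8
  · linear_combination (h1 + h2' - x - x' + y + y' - z - z') / 8
  · linear_combination (h1 + h2' - x - x' - y - y' + z + z') / 8
  · linear_combination (h1 - h2' - x + x' - y + y' - z + z') / 8

lemma solve (p : ℤ × ℤ × ℤ → ℂ)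
    (h0 : ∀ n ∈ Zs, ∑ δ ∈ Dbox 1 1 1, p δ * I ^ pair δ n = 0)
    (h1 : ∀ n ∈ Zs, ∑ δ ∈ Dbox 1 1 1, (p δ * (δ.1 : ℂ)) * I ^ pair δ n = 0)
    (h2 : ∀ n ∈ Zs, ∑ δ ∈ Dbox 1 1 1, (p δ * (δ.2.1 : ℂ)) * I ^ pair δ n = 0)
    (h3 : ∀ n ∈ Zs, ∑ δ ∈ Dbox 1 1 1, (p δ * (δ.2.2 : ℂ)) * I ^ pair δ n = 0) :
    ∀ δ ∈ Dbox 1 1 1, p δ = Kc δ * p (0,0,0) := by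
  have key := fun F (h : ∀ n ∈ Zs, ∑ δ ∈ Dbox 1 1 1, F δ * I ^ pair δ n = 0) =>
    classes F (h _ (by decide)) (h _ (by decide)) (h _ (by decide)) (h _ (by decide))
  have key' := fun F (h : ∀ n ∈ Zs, ∑ δ ∈ Dbox 1 1 1, F δ * I ^ pair δ n = 0) =>
    classes' F (h _ (by decide)) (h _ (by decide)) (h _ (by decide)) (h _ (by decide))
  obtain ⟨a1, a2, a3, a4⟩ := key _ h0
  obtain ⟨b1, b2, b3, b4⟩ := key _ h1
  obtain ⟨c1, c2, c3, c4⟩ := key _ h2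
  obtain ⟨d1, d2, d3, d4⟩ := key _ h3
  obtain ⟨a1', a2', a3', a4'⟩ := key' _ h0
  obtain ⟨b1', b2', b3', b4'⟩ := key' _ h1
  obtain ⟨c1', c2', c3', c4'⟩ := key' _ h2
  obtain ⟨d1', d2', d3', d4'⟩ := key' _ h3
  clear h0 h1 h2 h3 key key'
  push_cast at *
  obtain ⟨r1, r2, r3, r4, r5, r6⟩ := quad a2 a2' (by linear_combination b2) (by linear_combination b2')
    (by linear_combination c2) (by linear_combination d2)
  obtain ⟨s1, s2, s3, s4, s5, s6⟩ := quad a3 a3' (by linear_combination c3) (by linear_combination c3')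
    (by linear_combination b3) (by linear_combination d3)
  obtain ⟨t1, t2, t3, t4, t5, t6⟩ := quad a4 a4' (by linear_combination d4) (by linear_combination d4')
    (by linear_combination b4) (by linear_combination c4)
  obtain ⟨u1, u2, u3, u4, u5, u6, u7, u8⟩ := oct a1 a1' (by linear_combination b1)
    (by linear_combination I * b1' + (p (1,1,1) - p (1,1,-1) - p (1,-1,1) + p (1,-1,-1)
      + p (-1,1,1) - p (-1,1,-1) - p (-1,-1,1) + p (-1,-1,-1)) * I_sq)
    (by linear_combination c1)
    (by linear_combination I * c1' + (p (1,1,1) - p (1,1,-1) + p (1,-1,1) - p (1,-1,-1)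
      - p (-1,1,1) + p (-1,1,-1) - p (-1,-1,1) + p (-1,-1,-1)) * I_sq)
    (by linear_combination d1)
    (by linear_combination I * d1' + (p (1,1,1) + p (1,1,-1) - p (1,-1,1) - p (1,-1,-1)
      - p (-1,1,1) - p (-1,1,-1) + p (-1,-1,1) + p (-1,-1,-1)) * I_sq)
  intro δ hδ
  rw [dbox_eq] at hδ
  obtain ⟨k, l, m⟩ := δ
  simp only [Finset.mem_product, Finset.mem_insert, Finset.mem_singleton] at hδ
  obtain ⟨rfl | rfl | rfl, rfl | rfl | rfl, rfl | rfl | rfl⟩ := hδ <;>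
    simp [Kc, r1, r2, r3, r4, r5, r6, s1, s2, s3, s4, s5, s6, t1, t2, t3, t4, t5, t6,
      u1, u2, u3, u4, u5, u6, u7, u8] <;> first | ring1 | (left; ring1)

lemma crit (q : ℤ × ℤ × ℤ → ℂ) (g : ℝ × ℝ × ℝ → ℂ)
    (hg : g = fun v => ∑ δ ∈ Dbox 1 1 1, q δ * eChar δ v) (hpos : ∀ v, 0 ≤ g v)
    (w : ℝ × ℝ × ℝ) (hw : g w = 0) (d : ℝ × ℝ × ℝ) :
    ∑ δ ∈ Dbox 1 1 1, (q δ * ((δ.1 : ℂ) * d.1 + δ.2.1 * d.2.1 + δ.2.2 * d.2.2)) * eChar δ w = 0 := by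
  have hd : HasDerivAt (fun t : ℝ => g (w + t • d))
      (∑ δ ∈ Dbox 1 1 1, q δ * (eChar δ w *
        (I * ((δ.1 : ℂ) * d.1 + δ.2.1 * d.2.1 + δ.2.2 * d.2.2)))) 0 := by
    rw [hg]
    apply HasDerivAt.fun_sum
    intro δ _
    apply HasDerivAt.const_mul
    have h1 : HasDerivAt (fun t : ℝ => I * ((δ.1 : ℂ) * ((w.1 + t * d.1 : ℝ) : ℂ)
        + δ.2.1 * ((w.2.1 + t * d.2.1 : ℝ) : ℂ) + δ.2.2 * ((w.2.2 + t * d.2.2 : ℝ) : ℂ)))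
        (I * ((δ.1 : ℂ) * d.1 + δ.2.1 * d.2.1 + δ.2.2 * d.2.2)) 0 := by
      have hc : ∀ a b : ℝ, HasDerivAt (fun t : ℝ => ((a + t * b : ℝ) : ℂ)) (b : ℂ) 0 := by
        intro a b
        have : HasDerivAt (fun t : ℝ => a + t * b) b 0 := by
          simpa using ((hasDerivAt_id (0:ℝ)).mul_const b).const_add a
        exact this.ofReal_comp
      exact ((((hc _ _).const_mul _).add ((hc _ _).const_mul _)).add ((hc _ _).const_mul _)).const_mul _
    have h2 := h1.cexp
    simpa [eChar] using h2
  have hre : ∀ v, g v = ((g v).re : ℂ) := fun v => by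
    have := Complex.le_def.1 (hpos v)
    apply Complex.ext <;> simp
    simpa using this.2.symm
  set D := ∑ δ ∈ Dbox 1 1 1, q δ * (eChar δ w *
        (I * ((δ.1 : ℂ) * d.1 + δ.2.1 * d.2.1 + δ.2.2 * d.2.2))) with hD
  have hR : HasDerivAt (fun t : ℝ => (g (w + t • d)).re) D.re 0 := by
    exact (Complex.reCLM.hasFDerivAt.comp_hasDerivAt (0:ℝ) hd)
  have hIm : HasDerivAt (fun t : ℝ => (g (w + t • d)).im) D.im 0 := by
    exact (Complex.imCLM.hasFDerivAt.comp_hasDerivAt (0:ℝ) hd)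
  have hre0 : D.re = 0 := by
    apply IsLocalMin.hasDerivAt_eq_zero _ hR
    apply Filter.Eventually.of_forall
    intro t
    have := (Complex.le_def.1 (hpos (w + t • d))).1
    simpa [hw] using this
  have him0 : D.im = 0 := by
    have : (fun t : ℝ => (g (w + t • d)).im) = fun _ => 0 := by
      funext t; rw [hre]; simp
    rw [this] at hIm
    exact hIm.unique (hasDerivAt_const _ _)
  have hD0 : D = 0 := Complex.ext hre0 him0
  have : I * ∑ δ ∈ Dbox 1 1 1, (q δ * ((δ.1 : ℂ) * d.1 + δ.2.1 * d.2.1 + δ.2.2 * d.2.2)) * eChar δ w = 0 := by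
    rw [← hD0, hD, Finset.mul_sum]
    exact Finset.sum_congr rfl fun δ _ => by ring
  simpa using this

lemma coeffs (q : ℤ × ℤ × ℤ → ℂ) (g : ℝ × ℝ × ℝ → ℂ)
    (hg : g = fun v => ∑ δ ∈ Dbox 1 1 1, q δ * eChar δ v) (hpos : ∀ v, 0 ≤ g v)
    (hz : ∀ n ∈ Zs, g (pt n) = 0) :
    ∀ δ ∈ Dbox 1 1 1, q δ * eChar δ (pt 0) = Kc δ * q (0,0,0) := by
  have hc := fun n hn d => crit q g hg hpos (pt n) (hz n hn) d
  have := solve (fun δ => q δ * eChar δ (pt 0))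
    (fun n hn => by
      rw [← hz n hn, hg]
      exact Finset.sum_congr rfl fun δ _ => by rw [eChar_pt δ n]; ring)
    (fun n hn => by
      rw [← hc n hn (1,0,0)]
      exact Finset.sum_congr rfl fun δ _ => by rw [eChar_pt δ n]; push_cast; ring)
    (fun n hn => by
      rw [← hc n hn (0,1,0)]
      exact Finset.sum_congr rfl fun δ _ => by rw [eChar_pt δ n]; push_cast; ring)
    (fun n hn => by
      rw [← hc n hn (0,0,1)]
      exact Finset.sum_congr rfl fun δ _ => by rw [eChar_pt δ n]; push_cast; ring)
  have h0 : eChar (0,0,0) (pt 0) = 1 := by simp [eChar]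
  simpa [h0] using this

/-- The real function underlying `f`. -/
def fr (v : ℝ × ℝ × ℝ) : ℝ := (2 : ℝ) ^ ((3 : ℝ) / 2)
      - Real.cos (v.1 + v.2.1 + v.2.2) - Real.cos (-v.1 + v.2.1 + v.2.2)
      - Real.cos (v.1 - v.2.1 + v.2.2) + Real.cos (v.1 + v.2.1 - v.2.2)

lemma two_rpow : (2 : ℝ) ^ ((3 : ℝ) / 2) = 2 * √2 := by
  rw [show (3:ℝ)/2 = 1 + 1/2 by norm_num, Real.rpow_add (by norm_num), Real.rpow_one,
    Real.sqrt_eq_rpow]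

lemma fr_eq (v : ℝ × ℝ × ℝ) : fr v = 2 * √2 - 2 * Real.cos v.1 * Real.cos (v.2.1 + v.2.2)
    - 2 * Real.sin v.1 * Real.sin (v.2.1 - v.2.2) := by
  rw [fr, two_rpow, show v.1 + v.2.1 + v.2.2 = v.1 + (v.2.1 + v.2.2) by ring,
    show -v.1 + v.2.1 + v.2.2 = (v.2.1 + v.2.2) - v.1 by ring,
    show v.1 - v.2.1 + v.2.2 = v.1 - (v.2.1 - v.2.2) by ring,
    show v.1 + v.2.1 - v.2.2 = v.1 + (v.2.1 - v.2.2) by ring,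
    Real.cos_add v.1, Real.cos_add v.1, Real.cos_sub _ v.1, Real.cos_sub v.1]
  ring

lemma fr_nonneg (v : ℝ × ℝ × ℝ) : 0 ≤ fr v := by
  rw [fr_eq]
  have h1 := Real.sin_sq_add_cos_sq v.1
  have h2 := Real.cos_sq_le_one (v.2.1 + v.2.2)
  have h3 := Real.sin_sq_le_one (v.2.1 - v.2.2)
  generalize Real.cos (v.2.1 + v.2.2) = x at *
  generalize Real.sin (v.2.1 - v.2.2) = y at *
  generalize Real.sin v.1 = s at *
  generalize Real.cos v.1 = c at *
  have : c * x + s * y ≤ √2 := by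
    apply Real.le_sqrt_of_sq_le
    nlinarith [sq_nonneg (c * y - s * x), mul_nonneg (sq_nonneg c) (sub_nonneg.2 h2)]
  linarith

lemma fr_zero : ∀ n ∈ Zs, fr (pt n) = 0 := by
  intro n hn
  have hs : √2 * √2 = 2 := Real.mul_self_sqrt (by norm_num)
  have c1 : ∀ x, Real.cos (x + -(Real.pi/2)) = Real.sin x := fun x => by
    rw [← sub_eq_add_neg, Real.cos_sub_pi_div_two]
  have c2 : ∀ x, Real.sin (x + -(Real.pi/2)) = - Real.cos x := fun x => by
    rw [← sub_eq_add_neg, Real.sin_sub_pi_div_two]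
  have hp : 2 * (Real.pi / 2) = Real.pi := by ring
  rw [fr_eq, Real.cos_add, Real.sin_sub]
  simp only [Zs, Finset.mem_insert, Finset.mem_singleton] at hn
  rcases hn with rfl | rfl | rfl | rfl | rfl | rfl | rfl | rfl <;>
    simp [pt, c1, c2, hp, Real.cos_add_pi_div_two, Real.sin_add_pi_div_two] <;>
    linear_combination (-√2) * hs

/-- Fourier coefficients of `f`. -/
def fq (δ : ℤ × ℤ × ℤ) : ℂ :=
  if δ = (0,0,0) then ((2 * √2 : ℝ) : ℂ) else
  if δ = (1,1,1) ∨ δ = (-1,-1,-1) then -1/2 else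
  if δ = (-1,1,1) ∨ δ = (1,-1,-1) then -1/2 else
  if δ = (1,-1,1) ∨ δ = (-1,1,-1) then -1/2 else
  if δ = (1,1,-1) ∨ δ = (-1,-1,1) then 1/2 else 0

lemma fr_sum (v : ℝ × ℝ × ℝ) : (fr v : ℂ) = ∑ δ ∈ Dbox 1 1 1, fq δ * eChar δ v := by
  rw [sum27]
  simp only [sum3]
  simp [fq, fr, two_rpow, eChar, Complex.cos]
  ring_nf

theorem extremal_f_sqrt8 (f : ℝ × ℝ × ℝ → ℂ)
    (hf : f = fun v => (((2 : ℝ) ^ ((3 : ℝ) / 2)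
      - Real.cos (v.1 + v.2.1 + v.2.2) - Real.cos (-v.1 + v.2.1 + v.2.2)
      - Real.cos (v.1 - v.2.1 + v.2.2) + Real.cos (v.1 + v.2.1 - v.2.2) : ℝ) : ℂ)) :
    f ∈ sigmaSet 1 1 1 ∧
    ∀ g h : (ℝ × ℝ × ℝ) → ℂ, g ∈ sigmaSet 1 1 1 → h ∈ sigmaSet 1 1 1 → f = g + h →
      ∃ c : ℝ, 0 ≤ c ∧ g = fun v => (c : ℂ) * f v := by
  have hff : f = fun v => (fr v : ℂ) := hf
  have hfpos : ∀ v, 0 ≤ f v := fun v => by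
    rw [hff]; beta_reduce; exact_mod_cast fr_nonneg v
  have hfs : f = fun v => ∑ δ ∈ Dbox 1 1 1, fq δ * eChar δ v := by
    rw [hff]; funext v; exact fr_sum v
  have hfz : ∀ n ∈ Zs, f (pt n) = 0 := fun n hn => by
    rw [hff]; beta_reduce; exact_mod_cast fr_zero n hn
  refine ⟨⟨⟨fq, hfs⟩, hfpos⟩, ?_⟩
  rintro g h ⟨⟨q, hq⟩, hgpos⟩ ⟨-, hhpos⟩ hsum
  have hgz : ∀ n ∈ Zs, g (pt n) = 0 := fun n hn => by
    apply le_antisymm _ (hgpos _)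
    rw [← hfz n hn, hsum]
    exact le_add_of_nonneg_right (hhpos _)
  have hF := coeffs fq f hfs hfpos hfz
  have hG := coeffs q g hq hgpos hgz
  have hq0 : fq (0,0,0) ≠ 0 := by simp [fq]
  set c : ℂ := q (0,0,0) / fq (0,0,0) with hc
  have hqc : ∀ δ ∈ Dbox 1 1 1, q δ = c * fq δ := by
    intro δ hδ
    have he : eChar δ (pt 0) ≠ 0 := Complex.exp_ne_zero _
    apply mul_right_cancel₀ he
    rw [hG δ hδ, mul_assoc, hF δ hδ, hc]
    field_simp
  have hgc : ∀ v, g v = c * f v := by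
    intro v
    rw [hq, hfs]
    simp only [Finset.mul_sum]
    exact Finset.sum_congr rfl fun δ hδ => by rw [hqc δ hδ]; ring
  have hf0 : 0 < fr (0,0,0) := by
    rw [fr_eq]
    have : 1 < √2 := by rw [Real.lt_sqrt] <;> norm_num
    simp; linarith
  have h0 := hgpos (0,0,0)
  rw [hgc, hff] at h0
  have h1 := Complex.le_def.1 h0
  simp only [Complex.re_mul_ofReal, Complex.im_mul_ofReal, Complex.zero_re, Complex.zero_im] at h1
  have hre : 0 ≤ c.re := nonneg_of_mul_nonneg_left h1.1 hf0
  have him : c.im = 0 := by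
    rcases mul_eq_zero.1 h1.2.symm with h | h
    · exact h
    · exact absurd h hf0.ne'
  refine ⟨c.re, hre, ?_⟩
  funext v
  rw [hgc, show ((c.re : ℝ) : ℂ) = c from Complex.ext (by simp) (by simp [him])]
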